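/- arXiv:2510.14209 — 2 statements merged into one kernel-verified Lean document; each statement's English description precedes it below -/
import Mathlib

section
/- Let q ≥ 2 and n be positive integers with q ∣ n, and let a ∈ (ZMod q)^n be such that ∑_{k=1}^n a_k ≠ 0 in ZMod q. Then ∑_{x ∈ S} ζ_q^{a·x} = 0, where S is the set of all x ∈ (ZMod q)^n in which every element of ZMod q occurs exactly n/q times. -/
/-- `zetaPow q m = ζ_q ^ m = exp(2πi·m.val/q)` for `m : ZMod q`, where `ζ_q = exp(2πi/q)`. -/
noncomputable def zetaPow (q : ℕ) (m : ZMod q) : ℂ :=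
  Complex.exp (2 * Real.pi * Complex.I * (m.val : ℂ) / (q : ℂ))

theorem zetaPow_eq_stdAddChar (q : ℕ) [NeZero q] (m : ZMod q) :
    zetaPow q m = ZMod.stdAddChar m := by
  rw [zetaPow, ZMod.stdAddChar_apply, ZMod.toCircle_apply]

theorem stmt13 (q n : ℕ) [NeZero q] (hq : 2 ≤ q) (hn : 0 < n) (hdvd : q ∣ n)
    (a : Fin n → ZMod q) (ha : ∑ k, a k ≠ 0) :
    ∑ x ∈ Finset.univ.filter (fun x : Fin n → ZMod q =>
        ∀ g : ZMod q, (Finset.univ.filter (fun k => x k = g)).card = n / q),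
      zetaPow q (∑ k, a k * x k) = 0 := by
  simp only [zetaPow_eq_stdAddChar]
  have hne : (ZMod.stdAddChar (∑ k, a k) : ℂ) ≠ 1 := fun h =>
    ha (ZMod.injective_stdAddChar (h.trans (AddChar.map_zero_eq_one _).symm))
  -- Translating every coordinate by `1` permutes the balanced tuples and multiplies the sum by
  -- `ζ_q ^ (∑ k, a k) ≠ 1`.
  refine eq_zero_of_mul_eq_self_left hne ?_
  rw [Finset.mul_sum]
  refine Finset.sum_equiv (Equiv.addRight 1) (fun x => ?_) (fun x _ => ?_)
  · simp only [Finset.mem_filter_univ, Equiv.coe_addRight, Pi.add_apply, Pi.one_apply]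
    constructor
    · intro h g
      simpa only [eq_sub_iff_add_eq] using h (g - 1)
    · intro h g
      simpa only [add_left_inj] using h (g + 1)
  · simp only [← AddChar.map_add_eq_mul, Equiv.coe_addRight, Pi.add_apply, Pi.one_apply,
      mul_add, mul_one, Finset.sum_add_distrib]
    rw [add_comm]
end

section
/- Let q ≥ 2 and n be positive integers with q ∣ n, let a ∈ (ZMod q)^n, and let e ∈ (ZMod q)^n be the all-ones tuple. Then ∑_{x ∈ S} ζ_q^{(a+e)·x} = (−1)^{(q−1)n/q} · ∑_{x ∈ S} ζ_q^{a·x}, where S is the set of all x ∈ (ZMod q)^n in which every element of ZMod q occurs exactly n/q times. -/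
theorem ZMod.sum_univ_eq_natCast_sum_range (q : ℕ) [NeZero q] :
    ∑ g : ZMod q, g = ((∑ i ∈ Finset.range q, i : ℕ) : ZMod q) := by
  rw [Nat.cast_sum]
  refine Finset.sum_bij' (fun g _ => g.val) (fun i _ => (i : ZMod q)) ?_ ?_ ?_ ?_ ?_
  · exact fun g _ => Finset.mem_range.mpr g.val_lt
  · exact fun _ _ => Finset.mem_univ _
  · exact fun g _ => ZMod.natCast_zmod_val g
  · exact fun i hi => ZMod.val_cast_of_lt (Finset.mem_range.mp hi)
  · exact fun g _ => (ZMod.natCast_zmod_val g).symm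

theorem ZMod.stdAddChar_sum_univ (q : ℕ) [NeZero q] :
    ZMod.stdAddChar (∑ g : ZMod q, g) = (-1 : ℂ) ^ (q - 1) := by
  have hq : (q : ℂ) ≠ 0 := NeZero.ne _
  have hsum : ((∑ i ∈ Finset.range q, i : ℕ) : ℂ) * 2 = q * (q - 1 : ℕ) := by
    exact_mod_cast Finset.sum_range_id_mul_two q
  have hchar := ZMod.stdAddChar_coe (N := q) ((∑ i ∈ Finset.range q, i : ℕ) : ℤ)
  rw [Int.cast_natCast, Int.cast_natCast] at hchar
  rw [ZMod.sum_univ_eq_natCast_sum_range, hchar, ← Complex.exp_pi_mul_I, ← Complex.exp_nat_mul]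
  congr 1
  rw [div_eq_iff hq]
  linear_combination (Real.pi * Complex.I) * hsum

theorem sum_eq_nsmul_sum_univ_of_card_fiber_eq {ι M : Type*} [Fintype ι] [Fintype M]
    [DecidableEq M] [AddCommMonoid M] (x : ι → M) (c : ℕ)
    (hx : ∀ g, (Finset.univ.filter (fun k => x k = g)).card = c) :
    ∑ k, x k = c • ∑ g, g := by
  rw [← Finset.sum_fiberwise Finset.univ x x, Finset.smul_sum]
  refine Finset.sum_congr rfl fun g _ => ?_
  rw [Finset.sum_congr rfl fun k hk => (Finset.mem_filter.mp hk).2, Finset.sum_const, hx]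

theorem stmt14 (q n : ℕ) [NeZero q] (hq : 2 ≤ q) (hn : 0 < n) (hdvd : q ∣ n)
    (a : Fin n → ZMod q) :
    ∑ x ∈ Finset.univ.filter (fun x : Fin n → ZMod q =>
        ∀ g : ZMod q, (Finset.univ.filter (fun k => x k = g)).card = n / q),
      zetaPow q (∑ k, (a k + 1) * x k) =
    (-1 : ℂ) ^ ((q - 1) * (n / q)) *
      ∑ x ∈ Finset.univ.filter (fun x : Fin n → ZMod q =>
        ∀ g : ZMod q, (Finset.univ.filter (fun k => x k = g)).card = n / q),
        zetaPow q (∑ k, a k * x k) := by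
  rw [Finset.mul_sum]
  refine Finset.sum_congr rfl fun x hx => ?_
  have hsplit : ∑ k, (a k + 1) * x k = ∑ k, a k * x k + (n / q) • ∑ g : ZMod q, g := by
    rw [← sum_eq_nsmul_sum_univ_of_card_fiber_eq x (n / q) (Finset.mem_filter.mp hx).2,
      ← Finset.sum_add_distrib]
    exact Finset.sum_congr rfl fun k _ => by ring
  rw [zetaPow_eq_stdAddChar, zetaPow_eq_stdAddChar, hsplit, AddChar.map_add_eq_mul,
    AddChar.map_nsmul_eq_pow, ZMod.stdAddChar_sum_univ, pow_mul, mul_comm]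
end
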